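/- Let A be a densely defined normal operator on a complex Hilbert space H and let B be an everywhere-defined bounded self-adjoint operator on H satisfying BA* ⊂ −AB. Then (A+B)(A+B)* = AA* + B² and (A+B)*(A+B) = A*A + B², where A+B has domain D(A), B² is bounded and everywhere defined, and AA* + B² and A*A + B² have domains D(AA*) and D(A*A) respectively. -/

import Mathlib

open LinearPMap
open scoped InnerProductSpace

variable {H : Type*} [NormedAddCommGroup H] [InnerProductSpace ℂ H] [CompleteSpace H]

/-- The product `S * T` of unbounded operators, with domain
`{x ∈ D(T) : T x ∈ D(S)}` and value `x ↦ S (T x)`. -/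
noncomputable def LinearPMap.pmul (S T : H →ₗ.[ℂ] H) : H →ₗ.[ℂ] H :=
  S.comp (T.domRestrict ((Submodule.comap T.toFun S.domain).map T.domain.subtype))
    (fun x => by
      obtain ⟨y, hy, hyx⟩ := x.2.1
      have h : T.domRestrict _ x = T y := LinearPMap.domRestrict_apply hyx.symm
      rw [h]; exact hy)

/-- A densely defined closed operator `S` is normal if `S* S = S S*`
(as operators, with equal domains). -/
structure LinearPMap.IsNormalOp (S : H →ₗ.[ℂ] H) : Prop where
  dense : Dense (S.domain : Set H)
  isClosed : S.IsClosed
  adjoint_mul_comm : S†.pmul S = S.pmul S†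

namespace LinearPMap

omit [CompleteSpace H] in
theorem mem_graph_pmul_iff {S T : H →ₗ.[ℂ] H} {x z : H} :
    (x, z) ∈ (S.pmul T).graph ↔ ∃ y, (x, y) ∈ T.graph ∧ (y, z) ∈ S.graph := by
  simp only [mem_graph_iff]
  constructor
  · rintro ⟨⟨x', hx'⟩, rfl, rfl⟩
    obtain ⟨⟨y, hy, hyx⟩, -⟩ := Submodule.mem_inf.mp hx'
    have hTy : T.domRestrict _ ⟨x', hx'⟩ = T y := domRestrict_apply hyx.symm
    refine ⟨T y, ⟨y, hyx, rfl⟩, ⟨T y, hy⟩, rfl, ?_⟩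
    change S _ = S _
    congr 1
    exact Subtype.ext hTy.symm
  · rintro ⟨_, ⟨y, rfl, rfl⟩, ⟨w, hw, rfl⟩⟩
    have hy : T y ∈ S.domain := hw ▸ w.2
    have hdom : (y : H) ∈ (Submodule.comap T.toFun S.domain).map T.domain.subtype ⊓ T.domain :=
      ⟨⟨y, hy, rfl⟩, y.2⟩
    refine ⟨⟨y, hdom⟩, rfl, ?_⟩
    change S _ = S _
    congr 1
    apply Subtype.ext
    rw [hw]
    exact domRestrict_apply (x := ⟨(y : H), hdom⟩) rfl

omit [CompleteSpace H] in
theorem mem_graph_add_toPMap_iff {S : H →ₗ.[ℂ] H} {B : H →ₗ[ℂ] H} {x z : H} :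
    (x, z) ∈ (S + B.toPMap ⊤).graph ↔ (x, z - B x) ∈ S.graph := by
  simp only [mem_graph_iff]
  constructor
  · rintro ⟨y, rfl, rfl⟩
    refine ⟨⟨y, y.2.1⟩, rfl, ?_⟩
    rw [add_apply]
    simp
  · rintro ⟨y, rfl, hy⟩
    refine ⟨⟨y, y.2, trivial⟩, rfl, ?_⟩
    rw [add_apply]
    simp [hy]

theorem mem_graph_adjoint_iff {T : H →ₗ.[ℂ] H} (hT : Dense (T.domain : Set H)) {y w : H} :
    (y, w) ∈ T†.graph ↔ ∀ x x', (x, x') ∈ T.graph → ⟪w, x⟫_ℂ = ⟪y, x'⟫_ℂ := by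
  rw [adjoint_graph_eq_graph_adjoint hT, Submodule.mem_adjoint_iff]
  refine forall₃_congr fun a b _ => ?_
  rw [sub_eq_zero, ← inner_conj_symm, ← inner_conj_symm a, (RingHom.injective _).eq_iff, eq_comm]

theorem adjoint_add_toPMap {A : H →ₗ.[ℂ] H} (hA : Dense (A.domain : Set H)) {B : H →L[ℂ] H}
    (hB : ∀ x y : H, ⟪B x, y⟫_ℂ = ⟪x, B y⟫_ℂ) :
    (A + (B : H →ₗ[ℂ] H).toPMap ⊤)† = A† + (B : H →ₗ[ℂ] H).toPMap ⊤ := by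
  have hdom : (A + (B : H →ₗ[ℂ] H).toPMap ⊤).domain = A.domain := inf_top_eq _
  apply eq_of_eq_graph
  ext ⟨y, w⟩
  rw [mem_graph_add_toPMap_iff, mem_graph_adjoint_iff (by rwa [hdom]), mem_graph_adjoint_iff hA]
  simp only [mem_graph_add_toPMap_iff, ContinuousLinearMap.coe_coe, inner_sub_left, hB]
  constructor
  · intro h x x' hx
    rw [h x (x' + B x) (by simpa using hx), inner_add_right, add_sub_cancel_right]
  · intro h x x' hx
    have := h x _ hx
    rw [inner_sub_right] at this
    simpa using this

omit [CompleteSpace H] in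
/-- If `B T ⊂ -S B` then the mixed terms in `(S + B) (T + B)` cancel. -/
theorem add_toPMap_pmul_add_toPMap {S T : H →ₗ.[ℂ] H} {B : H →L[ℂ] H}
    (h : ∀ x y, (x, y) ∈ T.graph → (B x, -B y) ∈ S.graph) :
    (S + (B : H →ₗ[ℂ] H).toPMap ⊤).pmul (T + (B : H →ₗ[ℂ] H).toPMap ⊤) =
      S.pmul T + ((B * B : H →L[ℂ] H) : H →ₗ[ℂ] H).toPMap ⊤ := by
  apply eq_of_eq_graph
  ext ⟨x, z⟩
  simp only [mem_graph_add_toPMap_iff, mem_graph_pmul_iff, ContinuousLinearMap.coe_coe,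
    mul_apply_eq_comp]
  constructor
  · rintro ⟨y, hy, hz⟩
    refine ⟨_, hy, ?_⟩
    convert! sub_mem hz (h _ _ hy) using 1
    simp
  · rintro ⟨y, hy, hz⟩
    refine ⟨y + B x, by simpa using hy, ?_⟩
    convert! add_mem hz (h _ _ hy) using 1
    rw [Prod.mk_add_mk, _root_.map_add]
    congr 1
    abel

/-- For closed densely defined `A`, the operators `R = (1 + A* A)⁻¹` and `S = A R` are everywhere
defined and bounded, and `R` is self-adjoint. -/
theorem IsClosed.exists_one_add_adjoint_mul_self_inv {A : H →ₗ.[ℂ] H} (hA : A.IsClosed)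
    (hd : Dense (A.domain : Set H)) :
    ∃ R S : H →L[ℂ] H, IsSelfAdjoint R ∧
      (∀ y, (R y, S y) ∈ A.graph ∧ (S y, y - R y) ∈ A†.graph) ∧
      ∀ u v w, (u, v) ∈ A.graph → (v, w) ∈ A†.graph → R (u + w) = u := by
  let G : Submodule ℂ (WithLp 2 (H × H)) :=
    A.graph.comap (WithLp.linearEquiv 2 ℂ (H × H)).toLinearMap
  have hG : _root_.IsClosed (G : Set (WithLp 2 (H × H))) :=
    _root_.IsClosed.preimage (WithLp.prod_continuous_ofLp 2 H H) hA
  have : CompleteSpace G := hG.completeSpace_coe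
  let V : G →L[ℂ] H := (WithLp.fstL 2 ℂ H H).comp G.subtypeL
  let W : G →L[ℂ] H := (WithLp.sndL 2 ℂ H H).comp G.subtypeL
  have hmem : ∀ y, (V (V.adjoint y), W (V.adjoint y)) ∈ A.graph := fun y => (V.adjoint y).2
  have hmem' : ∀ y, (W (V.adjoint y), y - V (V.adjoint y)) ∈ A†.graph := by
    intro y
    rw [mem_graph_adjoint_iff hd]
    intro x x' hx
    have h := V.adjoint_inner_left (⟨WithLp.toLp 2 (x, x'), hx⟩ : G) y
    rw [Submodule.coe_inner, WithLp.prod_inner_apply] at h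
    rw [inner_sub_left]
    exact sub_eq_of_eq_add' h.symm
  refine ⟨V ∘L V.adjoint, W ∘L V.adjoint, ?_, fun y => ⟨hmem y, hmem' y⟩, ?_⟩
  · rw [ContinuousLinearMap.isSelfAdjoint_iff', ContinuousLinearMap.adjoint_comp,
      ContinuousLinearMap.adjoint_adjoint]
  · intro u v w huv hvw
    have h₁ := sub_mem huv (hmem (u + w))
    have h₂ := sub_mem hvw (hmem' (u + w))
    simp only [Prod.mk_sub_mk] at h₁ h₂
    have h := (mem_graph_adjoint_iff hd).mp h₂ _ _ h₁
    set d := u - V (V.adjoint (u + w)) with hdef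
    have hw : w - (u + w - V (V.adjoint (u + w))) = -d := by rw [hdef]; abel
    rw [hw, inner_neg_left, inner_self_eq_norm_sq_to_K, inner_self_eq_norm_sq_to_K] at h
    have h' : -‖d‖ ^ 2 = ‖v - W (V.adjoint (u + w))‖ ^ 2 := by exact_mod_cast h
    have : ‖d‖ = 0 := by nlinarith [sq_nonneg ‖d‖, sq_nonneg ‖v - W (V.adjoint (u + w))‖]
    exact (sub_eq_zero.mp (norm_eq_zero.mp this)).symm

/-- For normal `A`, the operators `R = (1 + A* A)⁻¹` and `S = A R` are bounded, `R` is self-adjoint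
and `S* = A* R`; moreover `R A ⊂ S`. -/
theorem IsNormalOp.exists_one_add_adjoint_mul_self_inv {A : H →ₗ.[ℂ] H} (hA : A.IsNormalOp) :
    ∃ R S : H →L[ℂ] H, IsSelfAdjoint R ∧ IsStarNormal S ∧ Commute R S ∧
      Function.Injective R ∧
      (∀ y, (R y, S y) ∈ A.graph) ∧ (∀ y, (R y, star S y) ∈ A†.graph) ∧
      ∀ x y, (x, y) ∈ A.graph → R y = S x := by
  obtain ⟨R, S, hR, hRS, hinv⟩ := hA.isClosed.exists_one_add_adjoint_mul_self_inv hA.dense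
  have hN : ∀ x z, (∃ y, (x, y) ∈ A.graph ∧ (y, z) ∈ A†.graph) ↔
      ∃ y, (x, y) ∈ A†.graph ∧ (y, z) ∈ A.graph := fun x z => by
    rw [← mem_graph_pmul_iff, ← mem_graph_pmul_iff, hA.adjoint_mul_comm]
  have hcomm : ∀ x y, (x, y) ∈ A.graph → R y = S x := by
    intro x y hxy
    obtain ⟨h₁, h₂⟩ := hRS x
    obtain ⟨s, hs, hs'⟩ := (hN _ _).mpr ⟨_, h₂, sub_mem hxy h₁⟩
    simpa using hinv _ _ _ hs hs'
  have hadj : ∀ y, (R y, star S y) ∈ A†.graph ∧ (star S y, y - R y) ∈ A.graph := by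
    intro y
    obtain ⟨t, ht, ht'⟩ := (hN _ _).mp ⟨_, hRS y⟩
    suffices h : star S y = t by rw [h]; exact ⟨ht, ht'⟩
    refine hA.dense.eq_of_inner_left ℂ fun x hx => ?_
    obtain ⟨x', hx'⟩ := mem_domain_iff.mp hx
    rw [(mem_graph_adjoint_iff hA.dense).mp ht _ _ hx', ContinuousLinearMap.star_eq_adjoint,
      ContinuousLinearMap.adjoint_inner_left, ← hcomm _ _ hx',
      ← ContinuousLinearMap.adjoint_inner_left, hR.adjoint_eq]
  have hcomm' : ∀ x y, (x, y) ∈ A†.graph → R y = star S x := by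
    intro x y hxy
    obtain ⟨h₁, h₂⟩ := hadj x
    simpa using hinv _ _ _ h₂ (sub_mem hxy h₁)
  refine ⟨R, S, hR, ⟨?_⟩, ?_, ?_, fun y => (hRS y).1, fun y => (hadj y).1, hcomm⟩
  · ext y
    exact (hcomm' _ _ (hRS y).2).symm.trans (hcomm _ _ (hadj y).2)
  · ext y
    exact hcomm _ _ (hRS y).1
  · rw [injective_iff_map_eq_zero]
    intro y hy
    obtain ⟨h₁, h₂⟩ := hRS y
    rw [hy] at h₁ h₂
    rw [A.graph_fst_eq_zero_snd h₁ rfl, sub_zero] at h₂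
    exact A†.graph_fst_eq_zero_snd h₂ rfl

end LinearPMap

/-- The spectral cutoffs of an injective self-adjoint operator `R` away from `0`: operators `g n`
in the bicommutant of `R` which converge strongly to `1`, on whose range `R` is invertible with
inverse `h n`. -/
theorem IsSelfAdjoint.exists_cutoff {R : H →L[ℂ] H} (hR : IsSelfAdjoint R)
    (hinj : Function.Injective R) :
    ∃ g h : ℕ → H →L[ℂ] H, (∀ n, R * h n * g n = g n) ∧ (∀ n, IsSelfAdjoint (h n)) ∧
      (∀ n T, Commute R T → Commute (g n) T ∧ Commute (h n) T) ∧
      (∀ n, ‖g n‖ ≤ 1) ∧ ∀ y, Filter.Tendsto (fun n => g n y) Filter.atTop (nhds y) := by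
  let γ : ℕ → ℝ → ℝ := fun n t => min 1 (max 0 ((n + 1) * t ^ 2 - 1))
  let η : ℕ → ℝ → ℝ := fun n t => (n + 1) * t * (max ((n + 1) * t ^ 2) 1)⁻¹
  have hγ : ∀ n, Continuous (γ n) := fun n => by fun_prop
  have hη : ∀ n, Continuous (η n) := fun n =>
    Continuous.mul (by fun_prop) (Continuous.inv₀ (by fun_prop) fun t => by positivity)
  have hγ0 : ∀ n t, 0 ≤ γ n t := fun n t => le_min zero_le_one (le_max_left _ _)
  have hγ1 : ∀ n t, γ n t ≤ 1 := fun n t => min_le_left _ _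
  have hmul : ∀ n t, t * η n t * γ n t = γ n t := by
    intro n t
    rcases le_total 1 ((n + 1) * t ^ 2) with h | h
    · have : t * η n t = 1 := by
        simp only [η, max_eq_left h]
        have := mul_inv_cancel₀ (zero_lt_one.trans_le h).ne'
        linear_combination this
      rw [this, one_mul]
    · have : γ n t = 0 := by simp [γ, h]
      rw [this, mul_zero]
  have hsmall : ∀ n t, ‖γ n t * t ^ 2 - t ^ 2‖ ≤ 2 / (n + 1) := by
    intro n t
    have hn : (0 : ℝ) < n + 1 := by positivity
    rw [Real.norm_eq_abs, abs_sub_comm, abs_of_nonneg (by nlinarith [hγ1 n t, sq_nonneg t]),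
      le_div_iff₀ hn]
    rcases le_total 2 ((n + 1) * t ^ 2) with h | h
    · have : γ n t = 1 := min_eq_left (le_max_of_le_right (by linarith))
      simp [this]
    · nlinarith [mul_nonneg (hγ0 n t) (mul_nonneg hn.le (sq_nonneg t))]
  have hnorm : ∀ n, ‖cfc (γ n) R‖ ≤ 1 := fun n =>
    norm_cfc_le zero_le_one fun t _ => by
      rw [Real.norm_eq_abs, abs_of_nonneg (hγ0 n t)]; exact hγ1 n t
  refine ⟨fun n => cfc (γ n) R, fun n => cfc (η n) R, fun n => ?_, fun n => cfc_predicate _ _,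
    fun n T hT => ⟨hT.cfc_real _, hT.cfc_real _⟩, hnorm, ?_⟩
  · change _ = cfc (γ n) R
    conv_rhs => rw [← funext (hmul n)]
    rw [cfc_mul _ _ R (by fun_prop) (by fun_prop), cfc_mul _ _ R (by fun_prop) (by fun_prop),
      cfc_id' ℝ R]
  have hsq : ∀ z, Filter.Tendsto (fun n => cfc (γ n) R ((R ^ 2) z)) Filter.atTop
      (nhds ((R ^ 2) z)) := by
    intro z
    rw [tendsto_iff_norm_sub_tendsto_zero]
    have hlim : Filter.Tendsto (fun n : ℕ => 2 / ((n : ℝ) + 1) * ‖z‖) Filter.atTop (nhds 0) := by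
      simpa using (tendsto_const_div_atTop_nhds_zero_nat (2 : ℝ)).comp
        (Filter.tendsto_add_atTop_nat 1) |>.mul_const ‖z‖
    refine squeeze_zero (fun _ => norm_nonneg _) (fun n => ?_) hlim
    have hcfc : cfc (γ n) R * R ^ 2 - R ^ 2 = cfc (fun t => γ n t * t ^ 2 - t ^ 2) R := by
      rw [cfc_sub _ _ R (by fun_prop) (by fun_prop), cfc_mul _ _ R (by fun_prop) (by fun_prop),
        cfc_pow_id R 2]
    change ‖(cfc (γ n) R * R ^ 2 - R ^ 2) z‖ ≤ _
    refine ContinuousLinearMap.le_of_opNorm_le _ ?_ z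
    rw [hcfc]
    exact norm_cfc_le (by positivity) fun t _ => hsmall n t
  have hdense : Dense (Set.range (R ^ 2 : H →L[ℂ] H)) := by
    have hker : ((R ^ 2 : H →L[ℂ] H)).rangeᗮ = ⊥ := by
      rw [ContinuousLinearMap.orthogonal_range, (hR.pow 2).adjoint_eq, LinearMap.ker_eq_bot,
        pow_two]
      exact hinj.comp hinj
    exact Submodule.dense_iff_topologicalClosure_eq_top.mpr
      (Submodule.topologicalClosure_eq_top_iff.mpr hker)
  intro y
  rw [Metric.tendsto_atTop]
  intro ε hε
  obtain ⟨_, ⟨z, rfl⟩, hz⟩ := Metric.mem_closure_iff.mp (hdense y) (ε / 3) (by positivity)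
  obtain ⟨N, hN⟩ := Metric.tendsto_atTop.mp (hsq z) (ε / 3) (by positivity)
  refine ⟨N, fun n hn => ?_⟩
  have h₁ : dist (cfc (γ n) R y) (cfc (γ n) R ((R ^ 2) z)) ≤ dist y ((R ^ 2) z) := by
    rw [dist_eq_norm, dist_eq_norm, ← _root_.map_sub]
    exact (ContinuousLinearMap.le_of_opNorm_le _ (hnorm n) _).trans_eq (one_mul _)
  have h₂ := hN n hn
  have h₃ := dist_triangle4 (cfc (γ n) R y) (cfc (γ n) R ((R ^ 2) z)) ((R ^ 2) z) y
  change dist (cfc (γ n) R y) y < ε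
  linarith [dist_comm y ((R ^ 2) z)]

/-- The Fuglede theorem for an unbounded normal operator: `B A* ⊂ -A B` implies
`B A ⊂ -A* B`. -/
theorem LinearPMap.IsNormalOp.anticommute_adjoint {A : H →ₗ.[ℂ] H} (hA : A.IsNormalOp)
    {B : H →L[ℂ] H} (hB : ∀ x y, (x, y) ∈ A†.graph → (B x, -B y) ∈ A.graph) (x y : H)
    (hxy : (x, y) ∈ A.graph) : (B x, -B y) ∈ A†.graph := by
  obtain ⟨R, S, hR, hS, hRS, hinj, hA₁, hA₂, hA₃⟩ := hA.exists_one_add_adjoint_mul_self_inv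
  obtain ⟨g, h, hgh, hh, hcomm, hnorm, hlim⟩ := hR.exists_cutoff hinj
  have hRS' : Commute R (star S) := by simpa [hR.star_eq] using hRS.star_star
  have hgB : ∀ u, Filter.Tendsto (fun n => g n (B (g n u))) Filter.atTop (nhds (B u)) := by
    intro u
    rw [tendsto_iff_norm_sub_tendsto_zero]
    have h₁ := tendsto_iff_norm_sub_tendsto_zero.mp ((B.continuous.tendsto u).comp (hlim u))
    have h₂ := tendsto_iff_norm_sub_tendsto_zero.mp (hlim (B u))
    refine squeeze_zero (fun _ => norm_nonneg _) (fun n => ?_) (by simpa using h₁.add h₂)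
    have h₃ := ContinuousLinearMap.le_of_opNorm_le _ (hnorm n) (B (g n u) - B u)
    rw [_root_.map_sub, one_mul] at h₃
    exact (norm_sub_le_norm_sub_add_norm_sub _ _ _).trans (add_le_add_left h₃ _)
  refine (adjoint_isClosed hA.dense).mem_of_tendsto ((hgB x).prodMk_nhds (hgB y).neg)
    (Filter.Eventually.of_forall fun n => ?_)
  obtain ⟨hgS, hhS⟩ := hcomm n S hRS
  obtain ⟨hgS', hhS'⟩ := hcomm n _ hRS'
  set P := S * h n with hP
  have hP' : star P = star S * h n := by rw [hP, star_mul, (hh n).star_eq, hhS'.eq]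
  have hgP : Commute (g n) P := hgS.mul_right ((hcomm n _ (hcomm n R (.refl R)).2.symm).1)
  have hgP' : Commute (g n) (star P) :=
    hP' ▸ hgS'.mul_right ((hcomm n _ (hcomm n R (.refl R)).2.symm).1)
  have hPn : IsStarNormal P := ⟨by
    rw [hP']
    exact .mul_left (.mul_right hS.star_comm_self hhS'.symm) (.mul_right hhS (.refl _))⟩
  have hgA' : ∀ u, (g n u, star P (g n u)) ∈ A†.graph := fun u => by
    have hu : R (h n (g n u)) = g n u := DFunLike.congr_fun (hgh n) u
    have := hA₂ (h n (g n u))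
    rw [hu] at this
    rw [hP']
    exact this
  have hPg : ∀ u v, (u, v) ∈ A.graph → g n v = P (g n u) := by
    intro u v huv
    have hR' := (hcomm n R (.refl R))
    calc g n v = (h n * g n) (R v) := by
          rw [← mul_apply_eq_comp (h n * g n), mul_assoc, hR'.1.eq, ← mul_assoc, hR'.2.eq, hgh]
      _ = P (g n u) := by
          rw [hA₃ _ _ huv, ← mul_apply_eq_comp, mul_assoc, hgS.eq, ← mul_assoc, hhS.eq]
          rfl
  have key : SemiconjBy (g n * B * g n) (star P) (-P) := by
    ext u
    have h₁ := hPg _ _ (hB _ _ (hgA' u))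
    have h₂ : star P (g n u) = g n (star P u) := DFunLike.congr_fun hgP'.eq.symm u
    rw [h₂, _root_.map_neg] at h₁
    exact neg_eq_iff_eq_neg.mp h₁
  have key' := key.star_right hPn.star hPn.neg
  rw [star_star, star_neg] at key'
  have h₁ : g n (B (g n y)) = -star P (g n (B (g n x))) := by
    rw [hPg _ _ hxy, ← mul_apply_eq_comp P, ← hgP.eq]
    exact DFunLike.congr_fun key'.eq x
  rw [h₁, neg_neg]
  exact hgA' _

theorem statement12 (A : H →ₗ.[ℂ] H) (hA : A.IsNormalOp)
    (B : H →L[ℂ] H) (hB : ∀ x y : H, ⟪B x, y⟫_ℂ = ⟪x, B y⟫_ℂ)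
    (hanti : ∀ x : A†.domain, ∃ h : B (x : H) ∈ A.domain,
      B (A† x) = - A ⟨B (x : H), h⟩) :
    (A + (B : H →ₗ[ℂ] H).toPMap ⊤).pmul (A + (B : H →ₗ[ℂ] H).toPMap ⊤)† =
      A.pmul A† + ((B * B : H →L[ℂ] H) : H →ₗ[ℂ] H).toPMap ⊤ ∧
    (A + (B : H →ₗ[ℂ] H).toPMap ⊤)†.pmul (A + (B : H →ₗ[ℂ] H).toPMap ⊤) =
      A†.pmul A + ((B * B : H →L[ℂ] H) : H →ₗ[ℂ] H).toPMap ⊤ := by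
  have hgraph : ∀ x y, (x, y) ∈ A†.graph → (B x, -B y) ∈ A.graph := by
    intro x y hxy
    obtain ⟨x, rfl, rfl⟩ := (mem_graph_iff _).mp hxy
    obtain ⟨h, hx⟩ := hanti x
    rw [hx, neg_neg]
    exact A.mem_graph ⟨B x, h⟩
  rw [adjoint_add_toPMap hA.dense hB]
  exact ⟨add_toPMap_pmul_add_toPMap hgraph,
    add_toPMap_pmul_add_toPMap (hA.anticommute_adjoint hgraph)⟩
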